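/- Let X be a nonempty finite type, let P : X → X → ℝ be a row-stochastic matrix, let γ be a real number with 0 ≤ γ < 1, and let ρ₀ : X → ℝ be a probability vector with ρ₀ x > 0 for every x. Define the occupancy measure ρ = ∑_{t=0}^∞ γ^t (ρ₀ ⬝ P^t) and the modified matrix P̃ x x' = (1-γ)·ρ₀ x' + γ·P x x'. Then (1-γ)·ρ is the unique probability vector v satisfying v ⬝ P̃ = v. -/

import Mathlib

open Matrix

lemma sum_vecMul_of_row_sum_eq_one {X : Type*} [Fintype X] {P : Matrix X X ℝ}
    (hP1 : ∀ x, ∑ y, P x y = 1) (v : X → ℝ) : ∑ y, (v ᵥ* P) y = ∑ x, v x := by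
  simp only [vecMul, dotProduct]
  rw [Finset.sum_comm]
  simp [← Finset.mul_sum, hP1]

lemma vecMul_nonneg_of_nonneg {X : Type*} [Fintype X] {P : Matrix X X ℝ}
    (hP0 : ∀ x y, 0 ≤ P x y) {v : X → ℝ} (hv : ∀ x, 0 ≤ v x) (y : X) : 0 ≤ (v ᵥ* P) y :=
  Finset.sum_nonneg fun x _ => mul_nonneg (hv x) (hP0 x y)

/-- A vector fixed by `w ↦ γ • (w ᵥ* P)`, with `P` row-stochastic and `γ < 1`, vanishes. -/
lemma eq_zero_of_eq_smul_vecMul {X : Type*} [Fintype X] {P : Matrix X X ℝ}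
    (hP0 : ∀ x y, 0 ≤ P x y) (hP1 : ∀ x, ∑ y, P x y = 1)
    {γ : ℝ} (hγ0 : 0 ≤ γ) (hγ1 : γ < 1) {w : X → ℝ} (hw : w = γ • (w ᵥ* P)) : w = 0 := by
  have hle : ∑ y, |w y| ≤ γ * ∑ x, |w x| := by
    calc ∑ y, |w y| ≤ ∑ y, γ * ((fun x => |w x|) ᵥ* P) y := by
          refine Finset.sum_le_sum fun y _ => ?_
          have hy : w y = γ * (w ᵥ* P) y := congrFun hw y
          rw [hy, abs_mul, abs_of_nonneg hγ0]
          refine mul_le_mul_of_nonneg_left ?_ hγ0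
          refine (Finset.abs_sum_le_sum_abs _ _).trans_eq ?_
          refine Finset.sum_congr rfl fun x _ => ?_
          rw [abs_mul, abs_of_nonneg (hP0 x y)]
      _ = γ * ∑ x, |w x| := by
          rw [← Finset.mul_sum, sum_vecMul_of_row_sum_eq_one hP1]
  have hnn : 0 ≤ ∑ y, |w y| := Finset.sum_nonneg fun y _ => abs_nonneg (w y)
  have hzero : ∑ y, |w y| = 0 := by nlinarith
  ext y
  exact abs_eq_zero.mp
    ((Finset.sum_eq_zero_iff_of_nonneg fun x _ => abs_nonneg (w x)).mp hzero y (Finset.mem_univ y))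

/-- With `ρ₀` strictly positive, `(1-γ) • ρ` (where `ρ` is the
occupancy measure) is the unique probability vector `v` with `v ᵥ* P̃ = v`. -/
theorem stmt_6 {X : Type*} [Fintype X] [Nonempty X] [DecidableEq X]
    (P : Matrix X X ℝ) (hP0 : ∀ x y, 0 ≤ P x y) (hP1 : ∀ x, ∑ y, P x y = 1)
    (γ : ℝ) (hγ0 : 0 ≤ γ) (hγ1 : γ < 1)
    (ρ₀ : X → ℝ) (hρ₀0 : ∀ x, 0 < ρ₀ x) (hρ₀1 : ∑ x, ρ₀ x = 1)
    (ρ : X → ℝ) (hρ : ρ = ∑' t : ℕ, γ ^ t • (ρ₀ ᵥ* (P ^ t)))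
    (Pt : Matrix X X ℝ) (hPt : ∀ x x', Pt x x' = (1 - γ) * ρ₀ x' + γ * P x x') :
    ((∀ x, 0 ≤ ((1 - γ) • ρ) x) ∧ ∑ x, ((1 - γ) • ρ) x = 1 ∧
      ((1 - γ) • ρ) ᵥ* Pt = (1 - γ) • ρ) ∧
    (∀ v : X → ℝ, (∀ x, 0 ≤ v x) → ∑ x, v x = 1 → v ᵥ* Pt = v → v = (1 - γ) • ρ) := by
  have hf0 : ∀ t x, 0 ≤ (ρ₀ ᵥ* (P ^ t)) x := by
    intro t
    induction t with
    | zero => simpa using fun x => (hρ₀0 x).le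
    | succ t ih =>
      rw [pow_succ, ← vecMul_vecMul]
      exact vecMul_nonneg_of_nonneg hP0 ih
  have hf1 : ∀ t, ∑ x, (ρ₀ ᵥ* (P ^ t)) x = 1 := by
    intro t
    induction t with
    | zero => simpa using hρ₀1
    | succ t ih => rw [pow_succ, ← vecMul_vecMul, sum_vecMul_of_row_sum_eq_one hP1, ih]
  have hsum : Summable fun t : ℕ => γ ^ t • (ρ₀ ᵥ* (P ^ t)) := by
    refine Pi.summable.mpr fun x => ?_
    refine Summable.of_nonneg_of_le (fun t => mul_nonneg (pow_nonneg hγ0 t) (hf0 t x))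
      (fun t => ?_) (summable_geometric_of_lt_one hγ0 hγ1)
    have hle : (ρ₀ ᵥ* (P ^ t)) x ≤ 1 :=
      hf1 t ▸ Finset.single_le_sum (fun y _ => hf0 t y) (Finset.mem_univ x)
    exact mul_le_of_le_one_right (pow_nonneg hγ0 t) hle
  have hρ_nonneg : ∀ x, 0 ≤ ρ x := by
    intro x
    rw [hρ, tsum_apply hsum]
    exact tsum_nonneg fun t => mul_nonneg (pow_nonneg hγ0 t) (hf0 t x)
  have hρ_fix : ρ = ρ₀ + γ • (ρ ᵥ* P) := by
    have hmap := (LinearMap.toContinuousLinearMap (Matrix.vecMulLinear P)).map_tsum hsum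
    simp only [LinearMap.coe_toContinuousLinearMap', Matrix.vecMulLinear_apply] at hmap
    rw [← hρ] at hmap
    rw [hmap, ← tsum_const_smul'' γ]
    conv_lhs => rw [hρ, hsum.tsum_eq_zero_add]
    simp [pow_succ', pow_succ P, smul_vecMul, smul_smul]
  have hρ_sum : (1 - γ) * ∑ x, ρ x = 1 := by
    have h : ∑ x, ρ x = 1 + γ * ∑ x, ρ x := by
      conv_lhs => rw [hρ_fix]
      simp only [Pi.add_apply, Pi.smul_apply, smul_eq_mul, Finset.sum_add_distrib,
        ← Finset.mul_sum, sum_vecMul_of_row_sum_eq_one hP1, hρ₀1]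
    linarith
  have hPt_apply : ∀ v : X → ℝ, ∑ x, v x = 1 → v ᵥ* Pt = (1 - γ) • ρ₀ + γ • (v ᵥ* P) := by
    intro v hv
    ext y
    simp only [vecMul, dotProduct, hPt, Pi.add_apply, Pi.smul_apply, smul_eq_mul, mul_add,
      Finset.sum_add_distrib, ← Finset.sum_mul, hv, one_mul, Finset.mul_sum]
    congr 1
    exact Finset.sum_congr rfl fun x _ => mul_left_comm _ _ _
  have hsum_one : ∑ x, ((1 - γ) • ρ) x = 1 := by
    simpa [← Finset.mul_sum] using hρ_sum
  have hstat : ((1 - γ) • ρ) ᵥ* Pt = (1 - γ) • ρ := by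
    rw [hPt_apply _ hsum_one, smul_vecMul, smul_comm γ, ← smul_add, ← hρ_fix]
  refine ⟨⟨fun x => mul_nonneg (sub_nonneg.mpr hγ1.le) (hρ_nonneg x), hsum_one, hstat⟩, ?_⟩
  intro v _ hv1 hv
  refine sub_eq_zero.mp (eq_zero_of_eq_smul_vecMul hP0 hP1 hγ0 hγ1 ?_)
  conv_lhs => rw [← hv, ← hstat, hPt_apply v hv1, hPt_apply _ hsum_one]
  rw [sub_vecMul, smul_sub, add_sub_add_left_eq_sub]
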